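/- Let c, d be elements of the graph group G_F with d ≤ dc, c ≤ dc, and d ≰ c. Suppose d is connected and every minimal symbol of c occurs in d. Then |c| ≤ |c ∧ d|². If moreover d is cyclically reduced, then c ≤ d^{|c ∧ d|}. -/

import Mathlib

open Pointwise

namespace GraphGroupPaper

/-- The set of commutator relators: `gᵢ` and `gⱼ` commute for every pair of distinct
`i, j` with `{i,j} ∉ F`. -/
def Rels (k : ℕ) (F : Set (Sym2 (Fin k))) : Set (FreeGroup (Fin k)) :=
  {w | ∃ i j : Fin k, i ≠ j ∧ s(i, j) ∉ F ∧
      w = FreeGroup.of i * FreeGroup.of j * (FreeGroup.of i)⁻¹ * (FreeGroup.of j)⁻¹}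

/-- The graph group `G_F` with generators `g₁, …, g_k` and relations `gᵢgⱼ = gⱼgᵢ`
for all distinct `i, j` with `{i,j} ∉ F`. -/
abbrev Grp (k : ℕ) (F : Set (Sym2 (Fin k))) := PresentedGroup (Rels k F)

/-- The generator `gᵢ` of the graph group. -/
def gen (k : ℕ) (F : Set (Sym2 (Fin k))) (i : Fin k) : Grp k F :=
  PresentedGroup.of i

/-- The group element corresponding to a symbol: `(i, true)` stands for `gᵢ`,
`(i, false)` stands for `gᵢ⁻¹`. -/
def sym (k : ℕ) (F : Set (Sym2 (Fin k))) (α : Fin k × Bool) : Grp k F :=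
  if α.2 then gen k F α.1 else (gen k F α.1)⁻¹

/-- The product of the word `l` of symbols, as an element of the graph group. -/
def wordProd (k : ℕ) (F : Set (Sym2 (Fin k))) (l : List (Fin k × Bool)) : Grp k F :=
  (l.map (sym k F)).prod

/-- `|x|` : the length of a shortest word in the symbols representing `x`. -/
noncomputable def len {k : ℕ} {F : Set (Sym2 (Fin k))} (x : Grp k F) : ℕ :=
  sInf {n | ∃ l : List (Fin k × Bool), wordProd k F l = x ∧ l.length = n}

/-- The partial order on `G_F`:  `x ≤ y` iff `|y| = |x| + |x⁻¹y|`. -/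
def le {k : ℕ} {F : Set (Sym2 (Fin k))} (x y : Grp k F) : Prop :=
  len y = len x + len (x⁻¹ * y)

/-- `m` is the meet `x ∧ y` (greatest lower bound w.r.t. `le`). -/
def IsMeet {k : ℕ} {F : Set (Sym2 (Fin k))} (x y m : Grp k F) : Prop :=
  le m x ∧ le m y ∧ ∀ w, le w x → le w y → le w m

/-- `j` is the (finite) join `x ∨ y` (least upper bound w.r.t. `le`);
`x ∨ y` is finite iff such a `j` exists. -/
def IsJoin {k : ℕ} {F : Set (Sym2 (Fin k))} (x y j : Grp k F) : Prop :=
  le x j ∧ le y j ∧ ∀ w, le x w → le y w → le j w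

/-- `j` is the (finite) join of the set `S`. -/
def IsJoinSet {k : ℕ} {F : Set (Sym2 (Fin k))} (S : Set (Grp k F)) (j : Grp k F) : Prop :=
  (∀ s ∈ S, le s j) ∧ ∀ w, (∀ s ∈ S, le s w) → le j w

/-- `y` is a segment of `a` if `a = x·y·z` for some `x, z`. -/
def Segment {k : ℕ} {F : Set (Sym2 (Fin k))} (y a : Grp k F) : Prop :=
  ∃ x z, a = x * y * z ∧ len a = len x + len y + len z

/-- The left-invariant metric `dist(x,y) = |x⁻¹y|`. -/
noncomputable def dist {k : ℕ} {F : Set (Sym2 (Fin k))} (x y : Grp k F) : ℕ :=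
  len (x⁻¹ * y)

/-- A nonempty set `L` is convex if `x, z ∈ L` and `dist(x,y) + dist(y,z) = dist(x,z)`
imply `y ∈ L`. -/
def ConvexSet {k : ℕ} {F : Set (Sym2 (Fin k))} (L : Set (Grp k F)) : Prop :=
  L.Nonempty ∧ ∀ x z y : Grp k F, x ∈ L → z ∈ L →
    dist x y + dist y z = dist x z → y ∈ L

/-- An ideal: nonempty, downward closed, and closed under finite joins. -/
def IdealSet {k : ℕ} {F : Set (Sym2 (Fin k))} (I : Set (Grp k F)) : Prop :=
  I.Nonempty ∧ (∀ x ∈ I, ∀ y, le y x → y ∈ I) ∧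
    (∀ x ∈ I, ∀ y ∈ I, ∀ j, IsJoin x y j → j ∈ I)

/-- `H` is closed if both `H` and `H⁻¹` are ideals. -/
def ClosedSet {k : ℕ} {F : Set (Sym2 (Fin k))} (H : Set (Grp k F)) : Prop :=
  IdealSet H ∧ IdealSet H⁻¹

/-- `m` is a minimal element of `S` w.r.t. `le`. -/
def MinimalIn {k : ℕ} {F : Set (Sym2 (Fin k))} (S : Set (Grp k F)) (m : Grp k F) : Prop :=
  m ∈ S ∧ ∀ x ∈ S, le x m → x = m

/-- `l` is a reduced (i.e. shortest) word representing `x`. -/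
def MinWord {k : ℕ} {F : Set (Sym2 (Fin k))} (x : Grp k F) (l : List (Fin k × Bool)) : Prop :=
  wordProd k F l = x ∧ l.length = len x

open Classical in
/-- `#_α(x)`: the number of occurrences of the symbol `α` (not counting `α⁻¹`)
in a reduced word representing `x`. -/
noncomputable def symCount {k : ℕ} {F : Set (Sym2 (Fin k))} (α : Fin k × Bool)
    (x : Grp k F) : ℕ :=
  if h : ∃ l, MinWord x l then h.choose.count α else 0

/-- The symbol `α` occurs in `x`. -/
def Occurs {k : ℕ} {F : Set (Sym2 (Fin k))} (α : Fin k × Bool) (x : Grp k F) : Prop :=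
  0 < symCount α x

/-- `α` is a maximal symbol of `x`, i.e. `xα⁻¹ ≤ x`. -/
def MaxSym {k : ℕ} {F : Set (Sym2 (Fin k))} (α : Fin k × Bool) (x : Grp k F) : Prop :=
  le (x * (sym k F α)⁻¹) x

/-- A peak: an element with precisely one maximal symbol. -/
def IsPeak {k : ℕ} {F : Set (Sym2 (Fin k))} (p : Grp k F) : Prop :=
  ∃! α : Fin k × Bool, MaxSym α p

/-- An `α`-peak: a peak whose unique maximal symbol is `α`. -/
def AlphaPeak {k : ℕ} {F : Set (Sym2 (Fin k))} (α : Fin k × Bool) (p : Grp k F) : Prop :=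
  MaxSym α p ∧ ∀ β, MaxSym β p → β = α

/-- The set of generator indices occurring in `b`. -/
def Support {k : ℕ} {F : Set (Sym2 (Fin k))} (b : Grp k F) : Set (Fin k) :=
  {i | Occurs (i, true) b ∨ Occurs (i, false) b}

/-- `b` is connected: the generators occurring in `b` induce a connected subgraph of
the graph `([k], F)`. -/
def Conn {k : ℕ} {F : Set (Sym2 (Fin k))} (b : Grp k F) : Prop :=
  (SimpleGraph.induce (Support b) (SimpleGraph.fromEdgeSet F)).Connected

/-- `b` is cyclically reduced: `b ∧ b⁻¹ = 1`. -/
def CycRed {k : ℕ} {F : Set (Sym2 (Fin k))} (b : Grp k F) : Prop :=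
  IsMeet b b⁻¹ 1

section

variable {k : ℕ} {F : Set (Sym2 (Fin k))}

/-- Two generator indices are dependent if they are equal or joined by an edge of `F`. -/
def Dep (F : Set (Sym2 (Fin k))) (i j : Fin k) : Prop := i = j ∨ s(i, j) ∈ F

lemma Dep.refl (i : Fin k) : Dep F i i := Or.inl rfl

lemma Dep.symm {i j : Fin k} (h : Dep F i j) : Dep F j i :=
  h.imp Eq.symm fun h => Sym2.eq_swap ▸ h

/-- The projection of a word to the symbols with index `i` or `j`. -/
def proj (i j : Fin k) (w : List (Fin k × Bool)) : List (Fin k × Bool) :=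
  w.filter fun a => a.1 = i ∨ a.1 = j

/-- The formal inverse of a symbol. -/
def flip (a : Fin k × Bool) : Fin k × Bool := (a.1, !a.2)

/-- `a` can be moved to the front of the word `w` by commutations. -/
def IsInitial (F : Set (Sym2 (Fin k))) (a : Fin k × Bool) (w : List (Fin k × Bool)) : Prop :=
  ∀ j, Dep F a.1 j → (proj a.1 j w).head? = some a

/-- Combinatorial reducedness: no symbol can be moved by commutations next to its inverse. -/
def Reduced (F : Set (Sym2 (Fin k))) : List (Fin k × Bool) → Prop
  | [] => True
  | a :: w => ¬ IsInitial F (flip a) w ∧ Reduced F w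

/-- Two words are equivalent if their projections to all dependent pairs agree. -/
def ProjEq (F : Set (Sym2 (Fin k))) (w w' : List (Fin k × Bool)) : Prop :=
  ∀ i j, Dep F i j → proj i j w = proj i j w'

@[simp] lemma flip_fst (a : Fin k × Bool) : (flip a).1 = a.1 := rfl

@[simp] lemma flip_flip (a : Fin k × Bool) : flip (flip a) = a := by simp [flip]

@[simp] lemma proj_nil (i j : Fin k) : proj i j [] = [] := rfl

@[simp] lemma proj_append (i j : Fin k) (u v : List (Fin k × Bool)) :
    proj i j (u ++ v) = proj i j u ++ proj i j v := List.filter_append ..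

lemma proj_cons_of_mem {i j : Fin k} {a : Fin k × Bool} (h : a.1 = i ∨ a.1 = j)
    (w : List (Fin k × Bool)) : proj i j (a :: w) = a :: proj i j w := by
  simp [proj, h]

lemma proj_cons_of_not_mem {i j : Fin k} {a : Fin k × Bool} (h : ¬ (a.1 = i ∨ a.1 = j))
    (w : List (Fin k × Bool)) : proj i j (a :: w) = proj i j w := by
  simp only [proj, List.filter_cons, h, decide_false, Bool.false_eq_true, if_false]

lemma mem_proj {i j : Fin k} {a : Fin k × Bool} {w : List (Fin k × Bool)} :
    a ∈ proj i j w ↔ a ∈ w ∧ (a.1 = i ∨ a.1 = j) := by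
  simp [proj]

lemma proj_eq_nil {i j : Fin k} {w : List (Fin k × Bool)}
    (h : ∀ a ∈ w, ¬ (a.1 = i ∨ a.1 = j)) : proj i j w = [] := by
  rw [List.eq_nil_iff_forall_not_mem]
  intro a ha
  exact h a (mem_proj.1 ha).1 (mem_proj.1 ha).2

lemma dep_of_mem {i j : Fin k} (h : Dep F i j) {x y : Fin k} (hx : x = i ∨ x = j)
    (hy : y = i ∨ y = j) : Dep F x y := by
  rcases hx with rfl | rfl <;> rcases hy with rfl | rfl
  exacts [Dep.refl _, h, h.symm, Dep.refl _]

lemma isInitial_cons_of_not_dep {a b : Fin k × Bool} (h : ¬ Dep F a.1 b.1)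
    (w : List (Fin k × Bool)) : IsInitial F a (b :: w) ↔ IsInitial F a w := by
  refine forall₂_congr fun j hj => ?_
  rw [proj_cons_of_not_mem]
  rintro (h' | h')
  · exact h (h' ▸ Dep.refl _)
  · exact h (h' ▸ hj)

lemma isInitial_cons_self (a : Fin k × Bool) (w : List (Fin k × Bool)) :
    IsInitial F a (a :: w) := fun j _ => by
  rw [proj_cons_of_mem (Or.inl rfl)]; rfl

lemma isInitial_append_cons {a : Fin k × Bool} {u v : List (Fin k × Bool)}
    (h : ∀ b ∈ u, ¬ Dep F a.1 b.1) : IsInitial F a (u ++ a :: v) := by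
  induction u with
  | nil => exact isInitial_cons_self a v
  | cons b u ih =>
    simp only [List.mem_cons, forall_eq_or_imp] at h
    exact (isInitial_cons_of_not_dep h.1 _).2 (ih h.2)

lemma IsInitial.eq_or_not_dep {a b : Fin k × Bool} {w : List (Fin k × Bool)}
    (h : IsInitial F a (b :: w)) : b = a ∨ ¬ Dep F a.1 b.1 := by
  by_contra! hc
  have := h b.1 hc.2
  rw [proj_cons_of_mem (Or.inr rfl)] at this
  exact hc.1 (by simpa using this)

lemma IsInitial.exists_split {a : Fin k × Bool} {w : List (Fin k × Bool)}
    (h : IsInitial F a w) :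
    ∃ u v, w = u ++ a :: v ∧ (∀ b ∈ u, ¬ Dep F a.1 b.1) ∧ w.erase a = u ++ v := by
  induction w with
  | nil => simpa using h a.1 (Dep.refl _)
  | cons b w ih =>
    by_cases hb : b = a
    · subst hb
      exact ⟨[], w, by simp⟩
    · have hd := h.eq_or_not_dep.resolve_left hb
      obtain ⟨u, v, rfl, hu, he⟩ := ih ((isInitial_cons_of_not_dep hd w).1 h)
      refine ⟨b :: u, v, rfl, by simpa using ⟨hd, by simpa using hu⟩, ?_⟩
      rw [List.erase_cons_tail (by simpa using hb), he]; rfl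

lemma IsInitial.proj_eq_cons {a : Fin k × Bool} {w : List (Fin k × Bool)}
    (h : IsInitial F a w) {i j : Fin k} (hij : Dep F i j) (ha : a.1 = i ∨ a.1 = j) :
    proj i j w = a :: proj i j (w.erase a) := by
  obtain ⟨u, v, rfl, hu, he⟩ := h.exists_split
  have : proj i j u = [] := proj_eq_nil fun b hb hb' => hu b hb (dep_of_mem hij ha hb')
  rw [he, proj_append, proj_append, this, proj_cons_of_mem ha]; rfl

lemma IsInitial.proj_erase {a : Fin k × Bool} {w : List (Fin k × Bool)}
    (h : IsInitial F a w) {i j : Fin k} (ha : ¬ (a.1 = i ∨ a.1 = j)) :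
    proj i j (w.erase a) = proj i j w := by
  obtain ⟨u, v, rfl, hu, he⟩ := h.exists_split
  rw [he, proj_append, proj_append, proj_cons_of_not_mem ha]

lemma IsInitial.mem {a : Fin k × Bool} {w : List (Fin k × Bool)}
    (h : IsInitial F a w) : a ∈ w := by
  obtain ⟨u, v, rfl, -, -⟩ := h.exists_split
  simp

lemma IsInitial.length_erase {a : Fin k × Bool} {w : List (Fin k × Bool)}
    (h : IsInitial F a w) : (w.erase a).length + 1 = w.length := by
  rw [List.length_erase_of_mem h.mem]
  have := List.length_pos_of_mem h.mem
  omega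

lemma ProjEq.isInitial_iff {w w' : List (Fin k × Bool)} (h : ProjEq F w w')
    (a : Fin k × Bool) : IsInitial F a w ↔ IsInitial F a w' :=
  forall₂_congr fun j hj => by rw [h _ _ hj]

lemma isInitial_erase_iff {a b : Fin k × Bool} (hab : ¬ Dep F a.1 b.1)
    {w : List (Fin k × Bool)} (h : IsInitial F b w) :
    IsInitial F a (w.erase b) ↔ IsInitial F a w := by
  refine forall₂_congr fun j hj => ?_
  rw [h.proj_erase]
  rintro (h' | h')
  · exact hab (h' ▸ Dep.refl _)
  · exact hab (h' ▸ hj)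

lemma Reduced.erase {a : Fin k × Bool} {w : List (Fin k × Bool)} (hw : Reduced F w)
    (h : IsInitial F a w) : Reduced F (w.erase a) := by
  induction w with
  | nil => exact trivial
  | cons b w ih =>
    by_cases hb : b = a
    · subst hb
      simpa using hw.2
    · have hd := h.eq_or_not_dep.resolve_left hb
      have h' := (isInitial_cons_of_not_dep hd w).1 h
      rw [List.erase_cons_tail (by simpa using hb)]
      exact ⟨fun hc => hw.1 ((isInitial_erase_iff (a := flip b) (fun h => hd h.symm) h').1 hc),
        ih hw.2 h'⟩

lemma Reduced.not_isInitial_flip_erase {a : Fin k × Bool} {w : List (Fin k × Bool)}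
    (hw : Reduced F w) (h : IsInitial F a w) : ¬ IsInitial F (flip a) (w.erase a) := by
  induction w with
  | nil => simpa using h.mem
  | cons b w ih =>
    by_cases hb : b = a
    · subst hb
      simpa using hw.1
    · have hd := h.eq_or_not_dep.resolve_left hb
      have h' := (isInitial_cons_of_not_dep hd w).1 h
      rw [List.erase_cons_tail (by simpa using hb), isInitial_cons_of_not_dep (a := flip a) hd]
      exact ih hw.2 h'

open Classical in
/-- Multiplication of a reduced word by a symbol on the left, followed by reduction. -/
noncomputable def act (F : Set (Sym2 (Fin k))) (a : Fin k × Bool) (w : List (Fin k × Bool)) :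
    List (Fin k × Bool) :=
  if IsInitial F (flip a) w then w.erase (flip a) else a :: w

lemma Reduced.act {w : List (Fin k × Bool)} (hw : Reduced F w) (a : Fin k × Bool) :
    Reduced F (act F a w) := by
  unfold GraphGroupPaper.act
  split_ifs with h
  exacts [hw.erase h, ⟨h, hw⟩]

lemma proj_act_of_not_mem {a : Fin k × Bool} {i j : Fin k} (ha : ¬ (a.1 = i ∨ a.1 = j))
    (w : List (Fin k × Bool)) : proj i j (act F a w) = proj i j w := by
  unfold act
  split_ifs with h
  exacts [h.proj_erase ha, proj_cons_of_not_mem ha w]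

open Classical in
lemma proj_act_of_mem {a : Fin k × Bool} {i j : Fin k} (hij : Dep F i j)
    (ha : a.1 = i ∨ a.1 = j) (w : List (Fin k × Bool)) :
    proj i j (act F a w) =
      if IsInitial F (flip a) w then (proj i j w).tail else a :: proj i j w := by
  unfold act
  split_ifs with h
  · rw [h.proj_eq_cons hij ha, List.tail_cons]
  · exact proj_cons_of_mem ha w

lemma ProjEq.act {w w' : List (Fin k × Bool)} (h : ProjEq F w w') (a : Fin k × Bool) :
    ProjEq F (act F a w) (act F a w') := by
  intro i j hij
  by_cases ha : a.1 = i ∨ a.1 = j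
  · rw [proj_act_of_mem hij ha, proj_act_of_mem hij ha, h i j hij]
    classical
    exact if_congr (h.isInitial_iff _) rfl rfl
  · simp only [proj_act_of_not_mem ha, h i j hij]

lemma act_flip_act {w : List (Fin k × Bool)} (hw : Reduced F w) (a : Fin k × Bool) :
    ProjEq F (act F (flip a) (act F a w)) w := by
  by_cases h : IsInitial F (flip a) w
  · have h1 : act F a w = w.erase (flip a) := if_pos h
    have h2 : act F (flip a) (w.erase (flip a)) = flip a :: w.erase (flip a) :=
      if_neg (hw.not_isInitial_flip_erase h)
    intro i j hij
    rw [h1, h2]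
    by_cases ha : a.1 = i ∨ a.1 = j
    · rw [h.proj_eq_cons hij ha, proj_cons_of_mem (a := flip a) ha]
    · rw [proj_cons_of_not_mem (a := flip a) ha, h.proj_erase ha]
  · have h1 : act F a w = a :: w := if_neg h
    have h2 : act F (flip a) (a :: w) = w := by
      unfold act
      rw [flip_flip, if_pos (isInitial_cons_self a w), List.erase_cons_head]
    rw [h1, h2]
    exact fun _ _ _ => rfl

lemma isInitial_act_iff {a b : Fin k × Bool} (hab : ¬ Dep F a.1 b.1)
    (w : List (Fin k × Bool)) : IsInitial F a (act F b w) ↔ IsInitial F a w := by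
  refine forall₂_congr fun j hj => ?_
  rw [proj_act_of_not_mem]
  rintro (h' | h')
  · exact hab (h' ▸ Dep.refl _)
  · exact hab (h' ▸ hj)

lemma act_comm {a b : Fin k × Bool} (hab : ¬ Dep F a.1 b.1) (w : List (Fin k × Bool)) :
    ProjEq F (act F a (act F b w)) (act F b (act F a w)) := by
  have hba : ¬ Dep F b.1 a.1 := fun h => hab h.symm
  intro i j hij
  by_cases ha : a.1 = i ∨ a.1 = j
  · have hb : ¬ (b.1 = i ∨ b.1 = j) := fun hb => hab (dep_of_mem hij ha hb)
    rw [proj_act_of_mem hij ha, proj_act_of_not_mem hb, proj_act_of_not_mem hb,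
      proj_act_of_mem hij ha]
    classical
    exact if_congr (isInitial_act_iff (a := flip a) hab w) rfl rfl
  · rw [proj_act_of_not_mem ha]
    by_cases hb : b.1 = i ∨ b.1 = j
    · rw [proj_act_of_mem hij hb, proj_act_of_mem hij hb, proj_act_of_not_mem ha]
      classical
      exact if_congr (isInitial_act_iff (a := flip b) hba w).symm rfl rfl
    · rw [proj_act_of_not_mem hb, proj_act_of_not_mem hb, proj_act_of_not_mem ha]

/-- Reduced words up to equality of their projections. -/
def reducedSetoid (F : Set (Sym2 (Fin k))) : Setoid {w : List (Fin k × Bool) // Reduced F w} where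
  r w w' := ProjEq F w.1 w'.1
  iseqv := ⟨fun _ _ _ _ => rfl, fun h i j hij => (h i j hij).symm,
    fun h₁ h₂ i j hij => (h₁ i j hij).trans (h₂ i j hij)⟩

/-- The action of a symbol on classes of reduced words. -/
noncomputable def actQuot (F : Set (Sym2 (Fin k))) (a : Fin k × Bool) :
    Quotient (reducedSetoid F) → Quotient (reducedSetoid F) :=
  Quotient.map (fun w => ⟨act F a w.1, w.2.act a⟩) fun _ _ h => ProjEq.act h a

lemma actQuot_flip (a : Fin k × Bool) (q : Quotient (reducedSetoid F)) :
    actQuot F (flip a) (actQuot F a q) = q := by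
  induction q using Quotient.inductionOn with
  | h w => exact Quotient.sound (act_flip_act w.2 a)

lemma actQuot_comm {a b : Fin k × Bool} (hab : ¬ Dep F a.1 b.1)
    (q : Quotient (reducedSetoid F)) :
    actQuot F a (actQuot F b q) = actQuot F b (actQuot F a q) := by
  induction q using Quotient.inductionOn with
  | h w => exact Quotient.sound (act_comm hab w.1)

/-- The permutation of classes of reduced words given by a generator. -/
noncomputable def genPerm (F : Set (Sym2 (Fin k))) (i : Fin k) :
    Equiv.Perm (Quotient (reducedSetoid F)) where
  toFun := actQuot F (i, true)
  invFun := actQuot F (i, false)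
  left_inv := actQuot_flip (i, true)
  right_inv := actQuot_flip (i, false)

/-- The action of the graph group on classes of reduced words. -/
noncomputable def wordAction (F : Set (Sym2 (Fin k))) :
    Grp k F →* Equiv.Perm (Quotient (reducedSetoid F)) :=
  PresentedGroup.toGroup (f := genPerm F) (by
    rintro r ⟨i, j, hne, hij, rfl⟩
    have : genPerm F i * genPerm F j = genPerm F j * genPerm F i :=
      Equiv.ext fun q => actQuot_comm (a := (i, true)) (b := (j, true))
        (fun h => h.elim hne hij) q
    simp [this])

lemma wordAction_sym (a : Fin k × Bool) (q : Quotient (reducedSetoid F)) :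
    wordAction F (sym k F a) q = actQuot F a q := by
  obtain ⟨i, b⟩ := a
  have : wordAction F (gen k F i) = genPerm F i := PresentedGroup.toGroup.of _
  cases b
  · simp only [sym, Bool.false_eq_true, if_false, map_inv, this]; rfl
  · simp only [sym, if_true, this]; rfl

@[simp] lemma wordProd_nil : wordProd k F [] = 1 := rfl

@[simp] lemma wordProd_cons (a : Fin k × Bool) (w : List (Fin k × Bool)) :
    wordProd k F (a :: w) = sym k F a * wordProd k F w := by simp [wordProd]

@[simp] lemma wordProd_append (u v : List (Fin k × Bool)) :
    wordProd k F (u ++ v) = wordProd k F u * wordProd k F v := by simp [wordProd]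

lemma wordAction_wordProd {w : List (Fin k × Bool)} (hw : Reduced F w) :
    wordAction F (wordProd k F w) (Quotient.mk (reducedSetoid F) ⟨[], trivial⟩) =
      Quotient.mk (reducedSetoid F) ⟨w, hw⟩ := by
  induction w with
  | nil => simp
  | cons a w ih =>
    rw [wordProd_cons, map_mul, Equiv.Perm.mul_apply, ih hw.2, wordAction_sym]
    refine Quotient.sound fun i j _ => ?_
    have : act F a w = a :: w := if_neg hw.1
    simp [this]

/-- Reduced words representing the same element agree up to commutations. -/
lemma Reduced.projEq {w w' : List (Fin k × Bool)} (hw : Reduced F w) (hw' : Reduced F w')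
    (h : wordProd k F w = wordProd k F w') : ProjEq F w w' := by
  have := wordAction_wordProd hw
  rw [h, wordAction_wordProd hw'] at this
  exact fun i j hij => (Quotient.exact this i j hij).symm

lemma length_eq_sum (w : List (Fin k × Bool)) : w.length = ∑ i, (proj i i w).length := by
  induction w with
  | nil => simp
  | cons a w ih =>
    have : ∀ i, (proj i i (a :: w)).length = (proj i i w).length + if a.1 = i then 1 else 0 := by
      intro i
      by_cases h : a.1 = i <;> simp [proj, h]
    simp [this, Finset.sum_add_distrib, ih]

lemma ProjEq.length_eq {w w' : List (Fin k × Bool)} (h : ProjEq F w w') :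
    w.length = w'.length := by
  rw [length_eq_sum w, length_eq_sum w']
  exact Finset.sum_congr rfl fun i _ => by rw [h i i (Dep.refl i)]

lemma ProjEq.mem {w w' : List (Fin k × Bool)} (h : ProjEq F w w') {a : Fin k × Bool}
    (ha : a ∈ w) : a ∈ w' := by
  have : a ∈ proj a.1 a.1 w := mem_proj.2 ⟨ha, Or.inl rfl⟩
  rw [h _ _ (Dep.refl _)] at this
  exact (mem_proj.1 this).1

lemma sym_flip (a : Fin k × Bool) : sym k F (flip a) = (sym k F a)⁻¹ := by
  obtain ⟨i, b⟩ := a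
  cases b <;> simp [sym, flip]

lemma gen_comm {i j : Fin k} (h : ¬ Dep F i j) : Commute (gen k F i) (gen k F j) := by
  have h' : i ≠ j ∧ s(i, j) ∉ F := not_or.1 h
  have : (PresentedGroup.mk (Rels k F))
      (FreeGroup.of i * FreeGroup.of j * (FreeGroup.of i)⁻¹ * (FreeGroup.of j)⁻¹) = 1 :=
    PresentedGroup.one_of_mem ⟨i, j, h'.1, h'.2, rfl⟩
  rw [map_mul, map_mul, map_mul, map_inv, map_inv, mul_inv_eq_one, mul_inv_eq_iff_eq_mul] at this
  exact this

lemma sym_comm {a b : Fin k × Bool} (h : ¬ Dep F a.1 b.1) :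
    Commute (sym k F a) (sym k F b) := by
  have := gen_comm h
  unfold sym
  split_ifs
  exacts [this, this.inv_right, this.inv_left, this.inv_inv]

lemma sym_comm_wordProd {a : Fin k × Bool} {u : List (Fin k × Bool)}
    (h : ∀ b ∈ u, ¬ Dep F a.1 b.1) : Commute (sym k F a) (wordProd k F u) := by
  induction u with
  | nil => exact Commute.one_right _
  | cons b u ih =>
    simp only [List.mem_cons, forall_eq_or_imp] at h
    rw [wordProd_cons]
    exact (sym_comm h.1).mul_right (ih h.2)

lemma IsInitial.wordProd_erase {a : Fin k × Bool} {w : List (Fin k × Bool)}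
    (h : IsInitial F a w) : sym k F a * wordProd k F (w.erase a) = wordProd k F w := by
  obtain ⟨u, v, rfl, hu, he⟩ := h.exists_split
  rw [he, wordProd_append, wordProd_append, wordProd_cons, ← mul_assoc, ← mul_assoc,
    (sym_comm_wordProd hu).eq]

lemma wordProd_act (a : Fin k × Bool) (w : List (Fin k × Bool)) :
    wordProd k F (act F a w) = sym k F a * wordProd k F w := by
  unfold act
  split_ifs with h
  · rw [← h.wordProd_erase, sym_flip, mul_inv_cancel_left]
  · rw [wordProd_cons]

lemma exists_reduced_length_le (w : List (Fin k × Bool)) :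
    ∃ w', Reduced F w' ∧ wordProd k F w' = wordProd k F w ∧ w'.length ≤ w.length := by
  induction w with
  | nil => exact ⟨[], trivial, rfl, le_rfl⟩
  | cons a w ih =>
    obtain ⟨w', hw', hp, hl⟩ := ih
    refine ⟨act F a w', hw'.act a, by rw [wordProd_act, hp, wordProd_cons], ?_⟩
    unfold act
    split_ifs with h
    · have := h.length_erase
      simp only [List.length_cons]
      omega
    · simpa using hl

lemma exists_wordProd_eq (x : Grp k F) : ∃ w, wordProd k F w = x := by
  induction x using PresentedGroup.induction_on with
  | _ z =>
    induction z using FreeGroup.induction_on with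
    | C1 => exact ⟨[], by simp⟩
    | of i => exact ⟨[(i, true)], by simp [sym]; rfl⟩
    | inv_of i _ => exact ⟨[(i, false)], by simp [sym]; rfl⟩
    | mul x y hx hy =>
      obtain ⟨u, hu⟩ := hx
      obtain ⟨v, hv⟩ := hy
      exact ⟨u ++ v, by rw [wordProd_append, hu, hv, map_mul]⟩

lemma len_wordProd_le (w : List (Fin k × Bool)) : len (wordProd k F w) ≤ w.length :=
  Nat.sInf_le ⟨w, rfl, rfl⟩

lemma exists_minWord (x : Grp k F) : ∃ w, MinWord x w :=
  Nat.sInf_mem (s := {n | ∃ l : List (Fin k × Bool), wordProd k F l = x ∧ l.length = n})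
    (let ⟨w, hw⟩ := exists_wordProd_eq x; ⟨w.length, w, hw, rfl⟩)

lemma Reduced.len_eq {w : List (Fin k × Bool)} (hw : Reduced F w) :
    len (wordProd k F w) = w.length := by
  obtain ⟨l, hl, hlen⟩ := exists_minWord (wordProd k F w)
  obtain ⟨l', hl', hp, hle⟩ := exists_reduced_length_le (F := F) l
  have := (hw.projEq hl' (by rw [hp, hl])).length_eq
  have := len_wordProd_le (F := F) w
  omega

lemma reduced_of_length_le {w : List (Fin k × Bool)} (h : w.length ≤ len (wordProd k F w)) :
    Reduced F w := by
  induction w with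
  | nil => exact trivial
  | cons a w ih =>
    obtain ⟨l, hl, hlen⟩ := exists_minWord (wordProd k F w)
    have h1 := len_wordProd_le (F := F) (a :: l)
    rw [wordProd_cons, hl, ← wordProd_cons] at h1
    simp only [List.length_cons] at h h1
    refine ⟨fun hc => ?_, ih (by omega)⟩
    have h2 : wordProd k F (a :: w) = wordProd k F (w.erase (flip a)) := by
      rw [wordProd_cons, ← hc.wordProd_erase, sym_flip, mul_inv_cancel_left]
    have h3 := len_wordProd_le (F := F) (w.erase (flip a))
    have := hc.length_erase
    rw [h2] at h
    omega

lemma exists_reduced (x : Grp k F) : ∃ w, Reduced F w ∧ wordProd k F w = x := by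
  obtain ⟨l, hl, hlen⟩ := exists_minWord x
  exact ⟨l, reduced_of_length_le (by rw [hl, hlen]), hl⟩

lemma len_mul_le (x y : Grp k F) : len (x * y) ≤ len x + len y := by
  obtain ⟨u, hu, hul⟩ := exists_minWord x
  obtain ⟨v, hv, hvl⟩ := exists_minWord y
  have := len_wordProd_le (F := F) (u ++ v)
  rw [wordProd_append, hu, hv, List.length_append] at this
  omega

lemma len_inv_le (x : Grp k F) : len x⁻¹ ≤ len x := by
  obtain ⟨u, rfl, hul⟩ := exists_minWord x
  have h : ∀ u : List (Fin k × Bool),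
      wordProd k F (u.map flip).reverse = (wordProd k F u)⁻¹ := by
    intro u
    induction u with
    | nil => simp
    | cons a u ih => simp [ih, sym_flip]
  rw [← hul, ← h]
  simpa using len_wordProd_le (F := F) (u.map flip).reverse

lemma len_inv (x : Grp k F) : len x⁻¹ = len x :=
  le_antisymm (len_inv_le x) (by simpa using len_inv_le x⁻¹)

lemma len_sym (a : Fin k × Bool) : len (sym k F a) = 1 := by
  have : Reduced F [a] := ⟨fun h => by simpa using h.mem, trivial⟩
  simpa using this.len_eq

lemma le_of_mul_eq {u v : List (Fin k × Bool)} {y : Grp k F}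
    (h : wordProd k F u * wordProd k F v = y) (hl : u.length + v.length ≤ len y) :
    le (wordProd k F u) y := by
  subst h
  have h1 := len_wordProd_le (F := F) u
  have h2 := len_wordProd_le (F := F) v
  have h3 := len_mul_le (wordProd k F u) (wordProd k F v)
  unfold le
  rw [inv_mul_cancel_left]
  omega

lemma exists_append_of_le {x y : Grp k F} (h : le x y) {u : List (Fin k × Bool)}
    (hu : Reduced F u) (hx : wordProd k F u = x) :
    ∃ v, Reduced F (u ++ v) ∧ wordProd k F (u ++ v) = y := by
  obtain ⟨v, hv, hvl⟩ := exists_minWord (x⁻¹ * y)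
  have hp : wordProd k F (u ++ v) = y := by rw [wordProd_append, hx, hv, mul_inv_cancel_left]
  refine ⟨v, reduced_of_length_le ?_, hp⟩
  rw [hp, h, ← hx, hu.len_eq, hx, List.length_append, hvl]

lemma Reduced.of_append {u v : List (Fin k × Bool)} (h : Reduced F (u ++ v)) : Reduced F v := by
  induction u with
  | nil => exact h
  | cons a u ih => exact ih h.2

lemma Reduced.occurs_iff {w : List (Fin k × Bool)} (hw : Reduced F w) (a : Fin k × Bool) :
    Occurs a (wordProd k F w) ↔ a ∈ w := by
  have h := exists_minWord (wordProd k F w)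
  have hm := h.choose_spec
  have hr : Reduced F h.choose := reduced_of_length_le (by rw [hm.1, hm.2])
  unfold Occurs symCount
  rw [dif_pos h, List.count_pos_iff]
  exact ⟨(hr.projEq hw hm.1).mem, (hw.projEq hr hm.1.symm).mem⟩

/-- A word whose projections are prefixes of those of `w` is a prefix of `w` up to
commutations. -/
lemma exists_append_of_proj_prefix {u w : List (Fin k × Bool)}
    (h : ∀ i j, Dep F i j → proj i j u <+: proj i j w) :
    ∃ v, wordProd k F (u ++ v) = wordProd k F w ∧ (u ++ v).length = w.length := by
  induction u generalizing w with
  | nil => exact ⟨w, rfl, rfl⟩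
  | cons a u ih =>
    have ha : IsInitial F a w := by
      intro j hj
      obtain ⟨t, ht⟩ := h _ _ hj
      rw [← ht, proj_cons_of_mem (Or.inl rfl)]; rfl
    obtain ⟨v, hv, hl⟩ := ih (w := w.erase a) (by
      intro i j hij
      have := h i j hij
      by_cases hm : a.1 = i ∨ a.1 = j
      · rw [ha.proj_eq_cons hij hm, proj_cons_of_mem hm] at this
        exact (List.cons_prefix_cons.1 this).2
      · rwa [ha.proj_erase hm, ← proj_cons_of_not_mem hm])
    refine ⟨v, ?_, ?_⟩
    · rw [List.cons_append, wordProd_cons, hv, ha.wordProd_erase]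
    · rw [List.cons_append, List.length_cons, hl, ha.length_erase]

/-- The `n`-fold concatenation of a word with itself. -/
def wordPow {α : Type*} (n : ℕ) (w : List α) : List α := (List.replicate n w).flatten

lemma wordPow_succ {α : Type*} (n : ℕ) (w : List α) : wordPow (n + 1) w = w ++ wordPow n w := rfl

lemma length_wordPow {α : Type*} (n : ℕ) (w : List α) : (wordPow n w).length = n * w.length := by
  simp [wordPow]

lemma proj_wordPow (i j : Fin k) (n : ℕ) (w : List (Fin k × Bool)) :
    proj i j (wordPow n w) = wordPow n (proj i j w) := by
  induction n with
  | zero => rfl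
  | succ n ih => rw [wordPow_succ, proj_append, ih, wordPow_succ]

lemma wordProd_wordPow (n : ℕ) (w : List (Fin k × Bool)) :
    wordProd k F (wordPow n w) = wordProd k F w ^ n := by
  induction n with
  | zero => rw [pow_zero]; rfl
  | succ n ih => rw [wordPow_succ, wordProd_append, ih, pow_succ']

lemma prefix_wordPow_append {α : Type*} {p l : List α} (h : l <+: p ++ l) (n : ℕ) :
    l <+: wordPow n p ++ l := by
  induction n with
  | zero => exact List.prefix_rfl
  | succ n ih =>
    rw [wordPow_succ, List.append_assoc]
    exact h.trans ((List.prefix_append_right_inj p).2 ih)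

lemma mem_of_prefix_append {α : Type*} {p l : List α} (hp : p ≠ []) (h : l <+: p ++ l)
    {a : α} (ha : a ∈ l) : a ∈ p := by
  have h1 : l <+: wordPow l.length p := by
    refine List.prefix_of_prefix_length_le (prefix_wordPow_append h _) (List.prefix_append ..) ?_
    rw [length_wordPow]
    exact Nat.le_mul_of_pos_right _ (List.length_pos_iff.2 hp)
  obtain ⟨q, hq, haq⟩ := List.mem_flatten.1 (h1.subset ha)
  exact List.eq_of_mem_replicate hq ▸ haq

/-- The number of symbols of index `i` in a word. -/
def idxCount (i : Fin k) (w : List (Fin k × Bool)) : ℕ := (proj i i w).length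

lemma idxCount_append (i : Fin k) (u v : List (Fin k × Bool)) :
    idxCount i (u ++ v) = idxCount i u + idxCount i v := by
  simp [idxCount]

lemma idxCount_wordPow (i : Fin k) (n : ℕ) (w : List (Fin k × Bool)) :
    idxCount i (wordPow n w) = n * idxCount i w := by
  rw [idxCount, proj_wordPow, length_wordPow, idxCount]

lemma idxCount_pos {a : Fin k × Bool} {w : List (Fin k × Bool)} (h : a ∈ w) :
    0 < idxCount a.1 w :=
  List.length_pos_of_mem (mem_proj.2 ⟨h, Or.inl rfl⟩)

lemma idxCount_eq_zero {i : Fin k} {w : List (Fin k × Bool)} (h : ∀ a ∈ w, a.1 ≠ i) :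
    idxCount i w = 0 := by
  rw [idxCount, proj_eq_nil]
  · rfl
  · intro a ha; simpa using h a ha

lemma idxCount_le_of_proj_prefix_left {i j : Fin k} {u v : List (Fin k × Bool)}
    (h : proj i j u <+: proj i j v) : idxCount i u ≤ idxCount i v := by
  have key : ∀ w, proj i i (proj i j w) = proj i i w := by
    intro w
    simp only [proj, List.filter_filter]
    refine List.filter_congr fun a _ => ?_
    by_cases h : a.1 = i <;> simp [h]
  have : proj i i (proj i j u) <+: proj i i (proj i j v) := h.filter _
  rw [key, key] at this
  exact this.length_le

lemma proj_comm (i j : Fin k) (w : List (Fin k × Bool)) : proj i j w = proj j i w := by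
  simp only [proj, or_comm]

lemma idxCount_le_of_proj_prefix_right {i j : Fin k} {u v : List (Fin k × Bool)}
    (h : proj i j u <+: proj i j v) : idxCount j u ≤ idxCount j v := by
  rw [proj_comm i j, proj_comm i j] at h
  exact idxCount_le_of_proj_prefix_left h

lemma idxCount_le_succ_mul {c p : List (Fin k × Bool)} {i j : Fin k}
    (h : proj i j c <+: proj i j p ++ proj i j c) (hj : 0 < idxCount j p) {t : ℕ}
    (ht : idxCount j c ≤ t * idxCount j p) : idxCount i c ≤ (t + 1) * idxCount i p := by
  have h1 := prefix_wordPow_append h (t + 1)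
  rw [← proj_wordPow] at h1
  rcases List.prefix_or_prefix_of_prefix h1 (List.prefix_append ..) with h2 | h2
  · rw [← idxCount_wordPow]
    exact idxCount_le_of_proj_prefix_left h2
  · have := idxCount_le_of_proj_prefix_right h2
    rw [idxCount_wordPow] at this
    nlinarith

lemma proj_length_le_of_idxCount {i j : Fin k} {u v : List (Fin k × Bool)}
    (hi : idxCount i u ≤ idxCount i v) (hj : idxCount j u ≤ idxCount j v) :
    (proj i j u).length ≤ (proj i j v).length := by
  by_cases hij : i = j
  · subst hij; exact hi
  · have key : ∀ w, (proj i j w).length = idxCount i w + idxCount j w := by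
      intro w
      induction w with
      | nil => rfl
      | cons a w ih =>
        unfold idxCount at ih ⊢
        by_cases h : a.1 = i
        · rw [proj_cons_of_mem (Or.inl h), proj_cons_of_mem (Or.inl h),
            proj_cons_of_not_mem (i := j) (by simpa [h] using hij)]
          simp only [List.length_cons]
          omega
        · rw [proj_cons_of_not_mem (i := i) (j := i) (by simpa using h)]
          by_cases h' : a.1 = j
          · rw [proj_cons_of_mem (Or.inr h'), proj_cons_of_mem (Or.inr h')]
            simp only [List.length_cons]
            omega
          · rw [proj_cons_of_not_mem (by simp [h, h']), proj_cons_of_not_mem (by simp [h'])]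
            exact ih
    rw [key, key]
    omega

lemma Reduced.mem_support_iff {w : List (Fin k × Bool)} (hw : Reduced F w) (i : Fin k) :
    i ∈ Support (wordProd k F w) ↔ ∃ a ∈ w, a.1 = i := by
  simp only [Support, Set.mem_ofPred_eq, hw.occurs_iff]
  constructor
  · rintro (h | h)
    exacts [⟨_, h, rfl⟩, ⟨_, h, rfl⟩]
  · rintro ⟨⟨i, b⟩, h, rfl⟩
    cases b
    exacts [Or.inr h, Or.inl h]

lemma Conn.exists_boundary {d : Grp k F} (hd : Conn d) {S : Set (Fin k)} {x y : Fin k}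
    (hx : x ∈ Support d) (hy : y ∈ Support d) (hxS : x ∈ S) (hyS : y ∉ S) :
    ∃ i j, i ∈ Support d ∧ j ∈ Support d ∧ i ∈ S ∧ j ∉ S ∧ Dep F i j := by
  obtain ⟨p⟩ := hd.preconnected ⟨x, hx⟩ ⟨y, hy⟩
  obtain ⟨e, -, h1, h2⟩ := p.exists_boundary_dart (Subtype.val ⁻¹' S) hxS hyS
  have := e.adj
  simp only [SimpleGraph.comap_adj, SimpleGraph.fromEdgeSet_adj] at this
  exact ⟨e.fst, e.snd, e.fst.2, e.snd.2, h1, h2, Or.inr this.1⟩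

lemma exists_first_split {α : Type*} (P : α → Prop) {w : List α} (hw : ∃ a ∈ w, P a) :
    ∃ x a y, w = x ++ a :: y ∧ P a ∧ ∀ b ∈ x, ¬ P b := by
  induction w with
  | nil => simp at hw
  | cons b w ih =>
    by_cases hb : P b
    · exact ⟨[], b, w, rfl, hb, by simp⟩
    · obtain ⟨x, a, y, rfl, ha, hx⟩ := ih (by simpa [hb] using hw)
      exact ⟨b :: x, a, y, rfl, ha, by simpa [hb] using hx⟩

lemma exists_common_initial {u v : List (Fin k × Bool)}
    (h : ∀ i j, Dep F i j → proj i j u <+: proj i j v ∨ proj i j v <+: proj i j u)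
    (hdep : ∃ a ∈ u, ∃ b ∈ v, Dep F a.1 b.1) : ∃ a, IsInitial F a u ∧ IsInitial F a v := by
  obtain ⟨x, a, y, rfl, ⟨b₀, hb₀, hab₀⟩, hx⟩ :=
    exists_first_split (fun a : Fin k × Bool => ∃ b ∈ v, Dep F a.1 b.1) hdep
  obtain ⟨z, b, t, rfl, hab, hz⟩ :=
    exists_first_split (fun b : Fin k × Bool => Dep F a.1 b.1) ⟨b₀, hb₀, hab₀⟩
  have hb : b ∈ z ++ b :: t := by simp
  have hu : proj a.1 b.1 (x ++ a :: y) = a :: proj a.1 b.1 y := by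
    rw [proj_append, proj_cons_of_mem (Or.inl rfl), proj_eq_nil, List.nil_append]
    exact fun c hc hc' => hx c hc ⟨b, hb, dep_of_mem hab hc' (Or.inr rfl)⟩
  have hv : proj a.1 b.1 (z ++ b :: t) = b :: proj a.1 b.1 t := by
    rw [proj_append, proj_cons_of_mem (Or.inr rfl), proj_eq_nil, List.nil_append]
    exact fun c hc hc' => hz c hc (dep_of_mem hab (Or.inl rfl) hc')
  have heq : a = b := by
    rcases h _ _ hab with h | h <;> rw [hu, hv] at h
    exacts [(List.cons_prefix_cons.1 h).1, (List.cons_prefix_cons.1 h).1.symm]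
  refine ⟨a, isInitial_append_cons fun c hc hc' => hx c hc ⟨b, hb, heq ▸ hc'.symm⟩, ?_⟩
  subst heq
  exact isInitial_append_cons hz

lemma IsInitial.of_append {a : Fin k × Bool} {u v : List (Fin k × Bool)}
    (h : IsInitial F a (u ++ v)) :
    IsInitial F a u ∨ (∀ b ∈ u, ¬ Dep F a.1 b.1) ∧ IsInitial F a v := by
  induction u with
  | nil => exact Or.inr ⟨by simp, h⟩
  | cons b u ih =>
    rcases h.eq_or_not_dep with rfl | hd
    · exact Or.inl (isInitial_cons_self _ _)
    · rw [isInitial_cons_of_not_dep hd]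
      refine (ih ((isInitial_cons_of_not_dep hd _).1 h)).imp_right fun h => ⟨?_, h.2⟩
      simpa using ⟨hd, by simpa using h.1⟩

lemma exists_cancellation {u v : List (Fin k × Bool)} (hu : Reduced F u) (hv : Reduced F v)
    (huv : ¬ Reduced F (u ++ v)) :
    ∃ a, IsInitial F a v ∧ ∃ s, s.length + 1 = u.length ∧
      wordProd k F u = wordProd k F s * (sym k F a)⁻¹ := by
  induction u with
  | nil => exact absurd hv huv
  | cons b u ih =>
    by_cases h : Reduced F (u ++ v)
    · have hb : IsInitial F (flip b) (u ++ v) := by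
        by_contra hb
        exact huv ⟨hb, h⟩
      obtain ⟨h1, h2⟩ := hb.of_append.resolve_left hu.1
      refine ⟨flip b, h2, u, rfl, ?_⟩
      rw [wordProd_cons, sym_flip, inv_inv, (sym_comm_wordProd h1 : Commute (sym k F b) _).eq]
    · obtain ⟨a, ha, s, hs, hp⟩ := ih hu.2 h
      exact ⟨a, ha, b :: s, by simpa using hs, by rw [wordProd_cons, wordProd_cons, hp, mul_assoc]⟩

lemma IsInitial.sym_le {a : Fin k × Bool} {w : List (Fin k × Bool)} (h : IsInitial F a w)
    (hw : Reduced F w) : le (sym k F a) (wordProd k F w) := by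
  have := le_of_mul_eq (u := [a]) (v := w.erase a) (y := wordProd k F w)
    (by simpa using h.wordProd_erase)
    (by rw [hw.len_eq, ← h.length_erase, List.length_singleton, add_comm])
  simpa using this

lemma reduced_append_self {w : List (Fin k × Bool)} (hw : Reduced F w)
    (hc : CycRed (wordProd k F w)) : Reduced F (w ++ w) := by
  by_contra h
  obtain ⟨a, ha, s, hs, hp⟩ := exists_cancellation hw hw h
  have h1 := ha.sym_le hw
  have h2 : le (sym k F a) (wordProd k F w)⁻¹ := by
    have h3 : (sym k F a)⁻¹ * (wordProd k F w)⁻¹ = (wordProd k F s)⁻¹ := by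
      rw [hp]; group
    have h4 := len_mul_le (sym k F a) ((sym k F a)⁻¹ * (wordProd k F w)⁻¹)
    rw [mul_inv_cancel_left] at h4
    have h5 := len_wordProd_le (F := F) s
    have h6 := hw.len_eq
    have h7 := len_sym (F := F) a
    unfold le
    rw [h3, len_inv, len_inv] at h4 ⊢
    omega
  have h3 := hc.2.2 _ h1 h2
  unfold le at h3
  rw [len_sym] at h3
  have : len (1 : Grp k F) = 0 := Reduced.len_eq (F := F) (w := []) trivial
  omega

lemma IsInitial.of_append_of_mem {a b : Fin k × Bool} {u v : List (Fin k × Bool)}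
    (h : IsInitial F a (u ++ v)) (hb : b ∈ u) (hab : b.1 = a.1) : IsInitial F a u :=
  h.of_append.resolve_right fun h' => h'.1 b hb (hab ▸ Dep.refl _)

lemma reduced_wordPow {w : List (Fin k × Bool)} (hw : Reduced F (w ++ w)) (n : ℕ) :
    Reduced F (wordPow n w) := by
  have hw' : Reduced F w := hw.of_append
  induction n with
  | zero => exact trivial
  | succ n ih =>
    cases n with
    | zero => simpa [wordPow] using hw'
    | succ n =>
      rw [wordPow_succ]
      have : ∀ t : List (Fin k × Bool), t ⊆ w → Reduced F (t ++ w) →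
          Reduced F (t ++ wordPow (n + 1) w) := by
        intro t
        induction t with
        | nil => exact fun _ _ => ih
        | cons a t iht =>
          intro ht hr
          refine ⟨fun hc => hr.1 ?_, iht (List.subset_of_cons_subset ht) hr.2⟩
          change IsInitial F _ (t ++ wordPow (n + 1) w) at hc
          rw [wordPow_succ, ← List.append_assoc] at hc
          exact hc.of_append_of_mem (b := a)
            (List.mem_append_right _ (ht List.mem_cons_self)) rfl
      exact this w (List.Subset.refl _) hw

/-- The growth bound: if `u` is periodic with period `p`, and the support of `p * v` is
connected with `u` and `v` independent, then no index occurs in `p * u` more than `|p|` times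
as often as in `p`. -/
lemma idxCount_le_length_mul {p u v : List (Fin k × Bool)} (hv : v ≠ [])
    (hred : Reduced F (p ++ v)) (hconn : Conn (wordProd k F (p ++ v)))
    (hind : ∀ a ∈ u, ∀ b ∈ v, ¬ Dep F a.1 b.1)
    (hpre : ∀ i j, Dep F i j → proj i j u <+: proj i j p ++ proj i j u)
    (hsupp : ∀ a ∈ u, ∃ b ∈ p, b.1 = a.1) (i : Fin k) :
    idxCount i (p ++ u) ≤ p.length * idxCount i p := by
  classical
  have hone : ∀ i, ∀ b ∈ v, Dep F i b.1 → idxCount i (p ++ u) = idxCount i p := by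
    intro i b hb hib
    rw [idxCount_append, idxCount_eq_zero (w := u), add_zero]
    rintro a ha rfl
    exact hind a ha b hb hib
  let I : Finset (Fin k) := (p.map Prod.fst).toFinset
  have hI : ∀ {i}, i ∈ I ↔ ∃ a ∈ p, a.1 = i := by simp [I]
  let A : ℕ → Finset (Fin k) := fun t =>
    I.filter fun i => t * idxCount i p < idxCount i (p ++ u)
  have hA : ∀ {t i}, i ∈ A t ↔ i ∈ I ∧ t * idxCount i p < idxCount i (p ++ u) := by
    simp [A]
  have hsub : ∀ t, A (t + 1) ⊆ A t := by
    intro t i hi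
    rw [hA] at hi ⊢
    exact ⟨hi.1, lt_of_le_of_lt (Nat.mul_le_mul_right _ t.le_succ) hi.2⟩
  have hstep : ∀ t, A (t + 1) = A t → A t = ∅ := by
    intro t heq
    by_contra hne
    obtain ⟨x, hx⟩ := Finset.nonempty_iff_ne_empty.2 hne
    obtain ⟨b, hb⟩ := List.exists_mem_of_ne_nil v hv
    have hnot : ∀ i ∈ A t, ∀ b ∈ v, ¬ Dep F i b.1 := by
      intro i hi b hb hd
      rw [← heq, hA, hone i b hb hd] at hi
      nlinarith [hi.2]
    obtain ⟨a, ha, hax⟩ := hI.1 (hA.1 hx).1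
    obtain ⟨i, j, -, hj, hiA, hjA, hij⟩ := hconn.exists_boundary (S := A t) (x := x) (y := b.1)
      ((hred.mem_support_iff _).2 ⟨a, by simp [ha], hax⟩)
      ((hred.mem_support_iff _).2 ⟨b, by simp [hb], rfl⟩) hx
      (fun h => hnot _ h b hb (Dep.refl _))
    obtain ⟨c, hc, rfl⟩ := (hred.mem_support_iff _).1 hj
    rcases List.mem_append.1 hc with hc | hc
    · have h1 : idxCount c.1 (p ++ u) ≤ t * idxCount c.1 p := by
        by_contra hlt
        exact hjA (hA.2 ⟨hI.2 ⟨c, hc, rfl⟩, not_le.1 hlt⟩)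
      have h2 := idxCount_le_succ_mul (c := p ++ u) (p := p) (i := i)
        (by
          rw [proj_append]
          exact (List.prefix_append_right_inj _).2 (hpre _ _ hij)) (idxCount_pos hc) h1
      rw [Finset.mem_coe, ← heq, hA] at hiA
      omega
    · exact hnot i hiA c hc hij
  have hcard : ∀ t, A t = ∅ ∨ (A t).card + t ≤ I.card := by
    intro t
    induction t with
    | zero => exact Or.inr (by simpa using Finset.card_filter_le _ _)
    | succ t ih =>
      by_cases heq : A (t + 1) = A t
      · exact Or.inl (heq ▸ hstep t heq)
      · have hlt := Finset.card_lt_card ((hsub t).ssubset_of_ne heq)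
        rcases ih with ih | ih
        · exact Or.inl (Finset.subset_empty.1 (ih ▸ hsub t))
        · exact Or.inr (by omega)
  have hlen : I.card ≤ p.length := by
    simpa using List.toFinset_card_le (p.map Prod.fst)
  have hempty : A p.length = ∅ :=
    (hcard p.length).elim id fun h => Finset.card_eq_zero.1 (by omega)
  by_cases hi : i ∈ I
  · by_contra hlt
    have : i ∈ A p.length := hA.2 ⟨hi, not_le.1 hlt⟩
    simp [hempty] at this
  · rw [idxCount_eq_zero]
    · exact Nat.zero_le _
    · rintro a ha rfl
      rcases List.mem_append.1 ha with ha | ha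
      exacts [hi (hI.2 ⟨a, ha, rfl⟩), hi (hI.2 (hsupp a ha))]

lemma IsInitial.append_sym_le {a : Fin k × Bool} {p w : List (Fin k × Bool)}
    (h : IsInitial F a w) (hw : Reduced F (p ++ w)) :
    le (wordProd k F (p ++ [a])) (wordProd k F (p ++ w)) := by
  refine le_of_mul_eq (v := w.erase a) ?_ ?_
  · rw [wordProd_append, wordProd_append, ← h.wordProd_erase]
    simp [mul_assoc]
  · rw [hw.len_eq, List.length_append, List.length_append, ← h.length_erase,
      List.length_singleton]
    omega

end

/-- if `d ≤ dc`, `c ≤ dc`, `d ≰ c`, `d` is connected and all minimal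
symbols of `c` occur in `d`, then `|c| ≤ |c ∧ d|²`; if moreover `d` is cyclically
reduced, then `c ≤ d^{|c ∧ d|}`. -/
theorem stmt16 {k : ℕ} (hk : 1 ≤ k) {F : Set (Sym2 (Fin k))}
    (c d : Grp k F)
    (h1 : le d (d * c)) (h2 : le c (d * c)) (h3 : ¬ le d c)
    (hconn : Conn d)
    (hmin : ∀ α : Fin k × Bool, le (sym k F α) c → Occurs α d)
    (m : Grp k F) (hm : IsMeet c d m) :
    len c ≤ (len m) ^ 2 ∧ (CycRed d → le c (d ^ (len m))) := by
  obtain ⟨p, hp, rfl⟩ := exists_reduced m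
  obtain ⟨u, hu, rfl⟩ := exists_append_of_le hm.1 hp rfl
  obtain ⟨v, hv, rfl⟩ := exists_append_of_le hm.2.1 hp rfl
  obtain ⟨y, hy, hyp⟩ := exists_append_of_le h2 hu rfl
  have hdc : Reduced F ((p ++ v) ++ (p ++ u)) := by
    refine reduced_of_length_le ?_
    rw [wordProd_append (p ++ v), h1, inv_mul_cancel_left, hu.len_eq, hv.len_eq,
      List.length_append (as := p ++ v)]
  have hproj := hdc.projEq hy (by rw [hyp, wordProd_append (p ++ v)])
  have hv0 : v ≠ [] := by
    rintro rfl
    rw [List.append_nil] at h3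
    exact h3 hm.1
  have hvu : ∀ i j, Dep F i j → proj i j v ++ (proj i j p ++ proj i j u) =
      proj i j u ++ proj i j y := by
    intro i j hij
    have := hproj i j hij
    simp only [proj_append, List.append_assoc] at this
    exact List.append_cancel_left this
  have hind : ∀ a ∈ u, ∀ b ∈ v, ¬ Dep F a.1 b.1 := by
    by_contra! hdep
    obtain ⟨a, hau, hav⟩ := exists_common_initial (fun i j hij =>
      List.prefix_or_prefix_of_prefix (List.prefix_append _ (proj i j y))
        (hvu i j hij ▸ List.prefix_append ..)) hdep
    have hle := hm.2.2 _ (hau.append_sym_le hu) (hav.append_sym_le hv)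
    unfold le at hle
    have h4 := len_mul_le (wordProd k F (p ++ [a])) (wordProd k F (u.erase a))
    have h5 : wordProd k F (p ++ [a]) * wordProd k F (u.erase a) = wordProd k F (p ++ u) := by
      rw [wordProd_append, wordProd_append, ← hau.wordProd_erase]
      simp [mul_assoc]
    have h6 := len_wordProd_le (F := F) (u.erase a)
    have h7 := hau.length_erase
    rw [h5, hu.len_eq, List.length_append] at h4
    rw [hp.len_eq] at hle
    omega
  have hpre : ∀ i j, Dep F i j → proj i j u <+: proj i j p ++ proj i j u := by
    intro i j hij
    by_cases hi : ∃ a ∈ u, a.1 = i ∨ a.1 = j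
    · obtain ⟨a, ha, hai⟩ := hi
      have := hvu i j hij
      rw [proj_eq_nil (w := v) fun b hb hbi => hind a ha b hb (dep_of_mem hij hai hbi)] at this
      exact ⟨_, this.symm⟩
    · push Not at hi
      rw [proj_eq_nil (w := u) fun a ha => not_or.2 (hi a ha)]
      exact List.nil_prefix
  have hsupp : ∀ a ∈ u, ∃ b ∈ p, b.1 = a.1 := by
    by_contra! hex
    obtain ⟨x, a, z, rfl, ha, hx⟩ :=
      exists_first_split (fun a : Fin k × Bool => ∀ b ∈ p, b.1 ≠ a.1) hex
    have hap : ∀ b ∈ p, ¬ Dep F a.1 b.1 := by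
      intro b hb hab
      have := mem_of_prefix_append (a := a)
        (List.ne_nil_of_mem (mem_proj.2 ⟨hb, Or.inr rfl⟩)) (hpre _ _ hab)
        (mem_proj.2 ⟨by simp, Or.inl rfl⟩)
      exact ha a (mem_proj.1 this).1 rfl
    have hinit : IsInitial F a (p ++ (x ++ a :: z)) := by
      rw [← List.append_assoc]
      refine isInitial_append_cons fun b hb => ?_
      rcases List.mem_append.1 hb with hb | hb
      · exact hap b hb
      · have := hx b hb
        push Not at this
        obtain ⟨c, hc, hcb⟩ := this
        exact hcb ▸ hap c hc
    have hocc := (hv.occurs_iff a).1 (hmin a (hinit.sym_le hu))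
    rcases List.mem_append.1 hocc with h | h
    · exact ha a h rfl
    · exact hind a (by simp) a h (Dep.refl _)
  have hcount := idxCount_le_length_mul hv0 hv hconn hind hpre hsupp
  rw [hu.len_eq, hp.len_eq]
  refine ⟨?_, fun hcyc => ?_⟩
  · rw [length_eq_sum (p ++ u), sq]
    nth_rw 2 [length_eq_sum p]
    rw [Finset.mul_sum]
    exact Finset.sum_le_sum fun i _ => hcount i
  · have hcount' : ∀ i, idxCount i (p ++ u) ≤ idxCount i (wordPow p.length (p ++ v)) := by
      intro i
      rw [idxCount_wordPow, idxCount_append i p v]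
      exact (hcount i).trans (Nat.mul_le_mul_left _ (Nat.le_add_right _ _))
    obtain ⟨w, hw, hwl⟩ := exists_append_of_proj_prefix (u := p ++ u)
      (w := wordPow p.length (p ++ v)) (F := F) (by
        intro i j hij
        have h4 : proj i j (p ++ u) <+: proj i j (p ++ v) ++ proj i j (p ++ u) := by
          have := hproj i j hij
          rw [proj_append _ _ (p ++ v), proj_append _ _ (p ++ u)] at this
          exact ⟨_, this.symm⟩
        refine List.prefix_of_prefix_length_le (prefix_wordPow_append h4 p.length) ?_
          (proj_length_le_of_idxCount (hcount' i) (hcount' j))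
        rw [proj_wordPow]
        exact List.prefix_append ..)
    rw [← wordProd_wordPow]
    refine le_of_mul_eq (v := w) (by rw [← hw, wordProd_append (p ++ u)]) ?_
    rw [(reduced_wordPow (reduced_append_self hv hcyc) _).len_eq, ← hwl,
      List.length_append (as := p ++ u)]

end GraphGroupPaper
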